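/- Let p be a prime number with p ≡ 1 (mod 24) and suppose B_{13,2}( 13(p−1)/24 ) ≡ 0 (mod 13). Then for every nonnegative integer α and every nonnegative integer n with p ∤ (24n + 13), we have B_{13,2}( p^{2α+1} n + 13(p^{2α+1} − 1)/24 ) ≡ 0 (mod 13). -/

import Mathlib

/-- The number of `t`-regular partitions of `n`, i.e. partitions of `n`
none of whose parts is divisible by `t`. -/
noncomputable def regularPartitionCount (t n : ℕ) : ℕ :=
  Nat.card {π : n.Partition // ∀ x ∈ π.parts, ¬ t ∣ x}

/-- `B u v n` is the number of `(u,v)`-regular bipartitions of `n`: pairs `(α, β)` of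
partitions with `|α| + |β| = n`, `α` being `u`-regular and `β` being `v`-regular. -/
noncomputable def B (u v n : ℕ) : ℕ :=
  ∑ i ∈ Finset.range (n + 1), regularPartitionCount u i * regularPartitionCount v (n - i)

section GeneratingFunctions

open PowerSeries PowerSeries.WithPiTopology

/-- The generating function of `regularPartitionCount t` with coefficients in `R`. -/
noncomputable def regularSeries (R : Type*) [CommRing R] (t : ℕ) : R⟦X⟧ :=
  PowerSeries.mk fun n ↦ (regularPartitionCount t n : R)

theorem regularPartitionCount_eq_card_restricted (t n : ℕ) :
    regularPartitionCount t n = (Nat.Partition.restricted n (¬ t ∣ ·)).card := by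
  rw [regularPartitionCount, Nat.card_eq_fintype_card, Fintype.card_subtype]
  rfl

theorem map_pentagonalSeries {R S : Type*} [CommRing R] [CommRing S] (f : R →+* S) :
    PowerSeries.map f (pentagonalSeries R) = pentagonalSeries S := by
  ext n
  by_cases h : n ∈ Set.range pentagonal
  · obtain ⟨k, rfl⟩ := h
    simp
  · simp [coeff_pentagonalSeries_eq_zero _ h]

theorem tprod_one_sub_X_pow_mul {R : Type*} [CommRing R] [TopologicalSpace R]
    [IsTopologicalRing R] [T2Space R] {t : ℕ} (ht : 0 < t) :
    HasProd (fun i : ℕ ↦ (1 - X ^ ((i + 1) * t) : R⟦X⟧))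
      (expand t ht.ne' (pentagonalSeries R)) := by
  have hc : Continuous (expand t ht.ne' : R⟦X⟧ → R⟦X⟧) := by
    rw [continuous_iff_continuousAt]
    intro f
    rw [ContinuousAt, tendsto_iff_coeff_tendsto]
    intro d
    simp only [coeff_expand]
    split_ifs
    · exact (continuous_coeff R _).tendsto f
    · exact tendsto_const_nhds
  have h := (hasProd_one_sub_X_pow R).map (expand t ht.ne').toMonoidHom hc
  convert h using 1
  · ext1 i
    simp [← pow_mul, mul_comm]
  · rfl

theorem regularSeries_mul_pentagonalSeries {R : Type*} [CommRing R] [NoZeroDivisors R]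
    {t : ℕ} (ht : 0 < t) :
    regularSeries R t * pentagonalSeries R = expand t ht.ne' (pentagonalSeries R) := by
  nontriviality R
  let _ : TopologicalSpace R := ⊥
  have _ : DiscreteTopology R := ⟨rfl⟩
  simp_rw [regularSeries, regularPartitionCount_eq_card_restricted]
  rw [Nat.Partition.powerSeriesMk_card_restricted_eq_tprod R (¬ t ∣ ·),
    ← (tprod_one_sub_X_pow_mul ht).tprod_eq, ← (hasProd_one_sub_X_pow R).tprod_eq,
    ← (Nat.Partition.multipliable_powerSeriesMk_card_restricted R (¬ t ∣ ·)).tprod_mul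
      (multipliable_one_sub_X_pow _)]
  simp_rw [ite_not, ite_mul, pow_mul]
  conv in fun b ↦ _ =>
    ext b
    rw [tsum_pow_mul_one_sub_of_constantCoeff_eq_zero (by simp)]
  refine tprod_eq_tprod_of_ne_one_bij (fun i ↦ (i.val + 1) * t - 1) ?_ ?_ ?_
  · intro a b h
    rw [tsub_left_inj (by nlinarith) (by nlinarith), mul_left_inj' ht.ne', add_left_inj] at h
    exact SetCoe.ext h
  · suffices ∀ (i : ℕ), t ∣ i + 1 → ∃ j ≠ 0, j * t - 1 = i by simpa
    intro i hi
    obtain ⟨j, hj⟩ := dvd_def.mp hi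
    refine ⟨j, by grind, Nat.sub_eq_of_eq_add ?_⟩
    rw [hj, mul_comm t j]
  · intro i
    have : (i + 1) * t - 1 + 1 = (i + 1) * t := by grind
    simp [this, pow_mul]

theorem expand_pentagonalSeries_eq_pow {R : Type*} [CommRing R] (q : ℕ) [Fact q.Prime]
    [CharP R q] :
    expand q (Fact.out : q.Prime).ne_zero (pentagonalSeries R) = pentagonalSeries R ^ q := by
  let _ : TopologicalSpace R := ⊥
  have _ : DiscreteTopology R := ⟨rfl⟩
  have _ : CharP R⟦X⟧ q := charP_of_injective_algebraMap (C_injective (R := R)) q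
  refine (tprod_one_sub_X_pow_mul (Fact.out : q.Prime).pos).unique ?_
  have h := (hasProd_one_sub_X_pow R).map (powMonoidHom q) (continuous_pow q)
  convert h using 1
  · ext1 i
    simp [sub_pow_char, pow_mul]
  · rfl

/-- The power series whose evaluation at `q` is `∏ (1 - qⁿ)ʳ (1 - q²ⁿ)ˢ`. -/
noncomputable def etaSeries (R : Type*) [CommRing R] (r s : ℕ) : R⟦X⟧ :=
  pentagonalSeries R ^ r * expand 2 two_ne_zero (pentagonalSeries R) ^ s

theorem map_etaSeries {R S : Type*} [CommRing R] [CommRing S] (f : R →+* S) (r s : ℕ) :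
    PowerSeries.map f (etaSeries R r s) = etaSeries S r s := by
  simp [etaSeries, map_pentagonalSeries]

theorem regularSeries_mul_regularSeries :
    regularSeries (ZMod 13) 13 * regularSeries (ZMod 13) 2 = etaSeries (ZMod 13) 11 1 := by
  have _ : Fact (Nat.Prime 13) := ⟨by norm_num⟩
  have h13 := regularSeries_mul_pentagonalSeries (R := ZMod 13) (t := 13) (by norm_num)
  have h2 := regularSeries_mul_pentagonalSeries (R := ZMod 13) (t := 2) (by norm_num)
  rw [expand_pentagonalSeries_eq_pow] at h13
  have h0 : pentagonalSeries (ZMod 13) ^ 2 ≠ 0 := by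
    refine pow_ne_zero _ fun h ↦ ?_
    simpa [h] using coeff_pentagonalSeries_pentagonal (ZMod 13) 0
  apply mul_right_cancel₀ h0
  rw [etaSeries]
  linear_combination (regularSeries (ZMod 13) 2 * pentagonalSeries (ZMod 13)) * h13 +
    pentagonalSeries (ZMod 13) ^ 13 * h2

theorem natCast_B_thirteen_two (n : ℕ) :
    (B 13 2 n : ZMod 13) = ((coeff n (etaSeries ℤ 11 1) : ℤ) : ZMod 13) := by
  have h : (((coeff n (etaSeries ℤ 11 1) : ℤ) : ZMod 13)) =
      coeff n (PowerSeries.map (Int.castRingHom (ZMod 13)) (etaSeries ℤ 11 1)) := by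
    simp
  rw [h, map_etaSeries, ← regularSeries_mul_regularSeries, coeff_mul,
    Finset.Nat.sum_antidiagonal_eq_sum_range_succ
      (fun i j ↦ coeff i (regularSeries (ZMod 13) 13) * coeff j (regularSeries (ZMod 13) 2))]
  simp [B, regularSeries]

theorem B_modEq_zero_iff (n : ℕ) :
    B 13 2 n ≡ 0 [MOD 13] ↔ (13 : ℤ) ∣ coeff n (etaSeries ℤ 11 1) := by
  rw [← ZMod.natCast_eq_natCast_iff, natCast_B_thirteen_two, Nat.cast_zero]
  exact ZMod.intCast_zmod_eq_zero_iff_dvd _ 13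

theorem coeff_zero_etaSeries (R : Type*) [CommRing R] (r s : ℕ) :
    coeff 0 (etaSeries R r s) = 1 := by
  have h := coeff_pentagonalSeries_pentagonal R 0
  have h0 : pentagonal 0 = 0 := by simp [pentagonal_def]
  rw [h0] at h
  simp only [etaSeries, coeff_zero_eq_constantCoeff, map_mul, map_pow, constantCoeff_expand]
  rw [coeff_zero_eq_constantCoeff] at h
  simp [h]

end GeneratingFunctions

section Evaluation

open PowerSeries Filter Topology

theorem norm_prod_one_sub_pow_le {x : ℂ} (hx : ‖x‖ < 1) (k n : ℕ) :
    ‖∏ i ∈ Finset.range n, (1 - x ^ (k + i + 1))‖ ≤ Real.exp (1 - ‖x‖)⁻¹ := by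
  rw [norm_prod]
  calc ∏ i ∈ Finset.range n, ‖1 - x ^ (k + i + 1)‖
      ≤ ∏ i ∈ Finset.range n, Real.exp (‖x‖ ^ i) := by
        refine Finset.prod_le_prod (fun _ _ ↦ norm_nonneg _) fun i _ ↦ ?_
        refine (norm_sub_le _ _).trans ?_
        rw [norm_one, norm_pow, add_comm]
        refine le_trans ?_ (Real.add_one_le_exp _)
        gcongr ?_ + 1
        exact pow_le_pow_of_le_one (norm_nonneg _) hx.le (by lia)
    _ = Real.exp (∑ i ∈ Finset.range n, ‖x‖ ^ i) := (Real.exp_sum _ _).symm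
    _ ≤ Real.exp (1 - ‖x‖)⁻¹ := by
        gcongr
        rw [← tsum_geometric_of_lt_one (norm_nonneg _) hx]
        exact (summable_geometric_of_lt_one (norm_nonneg _) hx).sum_le_tsum _
          fun _ _ ↦ by positivity

theorem norm_coeff_pentagonalSeries_le (n : ℕ) : ‖coeff n (pentagonalSeries ℂ)‖ ≤ 1 := by
  by_cases h : n ∈ Set.range pentagonal
  · obtain ⟨k, rfl⟩ := h
    rw [coeff_pentagonalSeries_pentagonal]
    rcases Int.units_eq_one_or k.negOnePow with h | h <;> simp [h]
  · simp [coeff_pentagonalSeries_eq_zero _ h]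

theorem summable_norm_coeff_pentagonalSeries_mul_pow {x : ℂ} (hx : ‖x‖ < 1) :
    Summable fun n ↦ ‖coeff n (pentagonalSeries ℂ) * x ^ n‖ := by
  refine (summable_geometric_of_lt_one (norm_nonneg _) hx).of_nonneg_of_le
    (fun _ ↦ norm_nonneg _) fun n ↦ ?_
  rw [norm_mul, norm_pow]
  exact mul_le_of_le_one_left (by positivity) (norm_coeff_pentagonalSeries_le n)

theorem hasSum_coeff_pentagonalSeries_mul_pow {x : ℂ} (hx : ‖x‖ < 1) :
    HasSum (fun n ↦ coeff n (pentagonalSeries ℂ) * x ^ n) (∏' n, (1 - x ^ (n + 1))) := by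
  have hsum := (summable_norm_coeff_pentagonalSeries_mul_pow hx).of_norm.hasSum
  have hgrouped : HasSum (fun k : ℕ ↦ (-1) ^ k * (x ^ pentagonal (-k) - x ^ pentagonal (k + 1)))
      (∑' n, coeff n (pentagonalSeries ℂ) * x ^ n) := by
    have h := hsum
    rw [← pentagonal_injective.hasSum_iff
      (fun n hn ↦ by simp [coeff_pentagonalSeries_eq_zero ℂ hn]),
      ← neg_injective.hasSum_iff (fun k hk ↦ by absurd hk; use -k; simp)] at h
    refine (HasSum.nat_add_neg_add_one h).congr_fun fun k ↦ ?_
    simp only [Function.comp_apply, coeff_pentagonalSeries_pentagonal, neg_neg, Int.negOnePow_add]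
    simp
    ring
  have hterm (k n : ℕ) : ‖x ^ ((k + 1) * n) * ∏ i ∈ Finset.range (n + 1), (1 - x ^ (k + i + 1))‖
      ≤ ‖x‖ ^ n * Real.exp (1 - ‖x‖)⁻¹ := by
    rw [norm_mul, norm_pow]
    gcongr ?_ * ?_
    · exact pow_le_pow_of_le_one (norm_nonneg _) hx.le (by nlinarith)
    · exact norm_prod_one_sub_pow_le hx _ _
  have hgeom : Summable fun n ↦ ‖x‖ ^ n * Real.exp (1 - ‖x‖)⁻¹ :=
    (summable_geometric_of_lt_one (norm_nonneg _) hx).mul_right _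
  rw [Pentagonal.tprod_one_sub_pow (x := x), hgrouped.tsum_eq]
  · exact hsum
  · exact tendsto_pow_atTop_nhds_zero_of_norm_lt_one hx
  · exact fun k ↦ hgeom.of_norm_bounded (hterm k)
  · intro k
    simp_rw [sub_eq_add_neg]
    apply multipliable_one_add_of_summable
    simp_rw [norm_neg, norm_pow, pow_add]
    exact ((summable_geometric_of_lt_one (norm_nonneg _) hx).mul_right _).mul_right _
  · exact hgrouped.summable
  · refine squeeze_zero_norm (a := fun k ↦ ‖x‖ ^ k * ∑' n, ‖x‖ ^ n * Real.exp (1 - ‖x‖)⁻¹)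
      (fun k ↦ ?_) ?_
    · simp only [norm_mul, norm_pow, norm_neg, norm_one, one_pow, one_mul]
      gcongr ?_ * ?_
      · refine pow_le_pow_of_le_one (norm_nonneg _) hx.le ?_
        rw [Nat.le_div_iff_mul_le two_pos]
        nlinarith
      · exact tsum_of_norm_bounded hgeom.hasSum (hterm k)
    · simpa using (tendsto_pow_atTop_nhds_zero_of_lt_one (norm_nonneg _) hx).mul_const
        (∑' n, ‖x‖ ^ n * Real.exp (1 - ‖x‖)⁻¹)

/-- The power series `S` converges absolutely on the open unit disc, with sum `φ`. -/
def EvaluatesTo (S : ℂ⟦X⟧) (φ : ℂ → ℂ) : Prop :=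
  ∀ q : ℂ, ‖q‖ < 1 → Summable (fun n ↦ ‖coeff n S * q ^ n‖) ∧
    HasSum (fun n ↦ coeff n S * q ^ n) (φ q)

theorem evaluatesTo_pentagonalSeries :
    EvaluatesTo (pentagonalSeries ℂ) fun q ↦ ∏' n, (1 - q ^ (n + 1)) := fun _ hq ↦
  ⟨summable_norm_coeff_pentagonalSeries_mul_pow hq, hasSum_coeff_pentagonalSeries_mul_pow hq⟩

namespace EvaluatesTo

theorem one : EvaluatesTo 1 1 := fun q _ ↦ by
  have h : (fun n ↦ coeff n (1 : ℂ⟦X⟧) * q ^ n) = fun n ↦ if n = 0 then 1 else 0 := by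
    ext n
    split_ifs with hn <;> simp [coeff_one, hn]
  have h' : (fun n ↦ ‖coeff n (1 : ℂ⟦X⟧) * q ^ n‖) = fun n ↦ if n = 0 then 1 else 0 := by
    ext n
    rw [congrFun h n]
    split_ifs <;> simp
  rw [h', h]
  exact ⟨(hasSum_ite_eq 0 1).summable, hasSum_ite_eq 0 1⟩

theorem mul {S T : ℂ⟦X⟧} {φ ψ : ℂ → ℂ} (hS : EvaluatesTo S φ) (hT : EvaluatesTo T ψ) :
    EvaluatesTo (S * T) (φ * ψ) := fun q hq ↦ by
  obtain ⟨hS1, hS2⟩ := hS q hq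
  obtain ⟨hT1, hT2⟩ := hT q hq
  have h : (fun n ↦ coeff n (S * T) * q ^ n) = fun n ↦ ∑ kl ∈ Finset.HasAntidiagonal.antidiagonal n,
      coeff kl.1 S * q ^ kl.1 * (coeff kl.2 T * q ^ kl.2) := by
    ext n
    rw [coeff_mul, Finset.sum_mul]
    refine Finset.sum_congr rfl fun kl hkl ↦ ?_
    rw [← Finset.HasAntidiagonal.mem_antidiagonal.mp hkl, pow_add]
    ring
  have hs := summable_norm_sum_mul_antidiagonal_of_summable_norm hS1 hT1
  have ht := tsum_mul_tsum_eq_tsum_sum_antidiagonal_of_summable_norm hS1 hT1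
  rw [hS2.tsum_eq, hT2.tsum_eq] at ht
  have h' : (fun n ↦ ‖coeff n (S * T) * q ^ n‖) = fun n ↦ ‖∑ kl ∈ Finset.HasAntidiagonal.antidiagonal n,
      coeff kl.1 S * q ^ kl.1 * (coeff kl.2 T * q ^ kl.2)‖ := by
    ext n
    rw [congrFun h n]
  rw [h', h, Pi.mul_apply, ht]
  exact ⟨hs, hs.of_norm.hasSum⟩

theorem pow {S : ℂ⟦X⟧} {φ : ℂ → ℂ} (hS : EvaluatesTo S φ) (n : ℕ) :
    EvaluatesTo (S ^ n) (φ ^ n) := by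
  induction n with
  | zero => simpa using one
  | succ n ih => simpa [pow_succ] using ih.mul hS

theorem expand {S : ℂ⟦X⟧} {φ : ℂ → ℂ} (hS : EvaluatesTo S φ) {t : ℕ} (ht : t ≠ 0) :
    EvaluatesTo (PowerSeries.expand t ht S) fun q ↦ φ (q ^ t) := fun q hq ↦ by
  obtain ⟨h1, h2⟩ := hS (q ^ t) (by
    rw [norm_pow]
    exact pow_lt_one₀ (norm_nonneg _) hq ht)
  have hinj : Function.Injective (t * ·) := mul_right_injective₀ ht
  have h0 (n : ℕ) (hn : n ∉ Set.range (t * ·)) :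
      coeff n (PowerSeries.expand t ht S) * q ^ n = 0 := by
    rw [coeff_expand, if_neg, zero_mul]
    rintro ⟨m, rfl⟩
    exact hn ⟨m, rfl⟩
  have hcomp (m : ℕ) : coeff (t * m) (PowerSeries.expand t ht S) * q ^ (t * m) =
      coeff m S * (q ^ t) ^ m := by
    rw [coeff_expand, if_pos ⟨m, rfl⟩, Nat.mul_div_cancel_left _ (Nat.pos_of_ne_zero ht), pow_mul]
  constructor
  · rw [← hinj.summable_iff (fun n hn ↦ by rw [h0 n hn, norm_zero])]
    exact h1.congr fun m ↦ by rw [Function.comp_apply, hcomp]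
  · rw [← hinj.hasSum_iff h0]
    exact h2.congr_fun fun m ↦ hcomp m

end EvaluatesTo

/-- The Euler product `∏ (1 - qⁿ)`. -/
noncomputable def eulerProduct (q : ℂ) : ℂ := ∏' n : ℕ, (1 - q ^ (n + 1))

theorem evaluatesTo_etaSeries (r s : ℕ) :
    EvaluatesTo (etaSeries ℂ r s) fun q ↦ eulerProduct q ^ r * eulerProduct (q ^ 2) ^ s :=
  (evaluatesTo_pentagonalSeries.pow r).mul ((evaluatesTo_pentagonalSeries.expand two_ne_zero).pow s)

end Evaluation

section HeckeExpansion

open Complex Matrix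

/-- The function `x ↦ exp (2πix)`. -/
noncomputable def expTwoPiI (x : ℂ) : ℂ := cexp (2 * Real.pi * I * x)

theorem expTwoPiI_add (x y : ℂ) : expTwoPiI (x + y) = expTwoPiI x * expTwoPiI y := by
  rw [expTwoPiI, mul_add, exp_add, expTwoPiI, expTwoPiI]

theorem expTwoPiI_nat_mul (n : ℕ) (x : ℂ) : expTwoPiI (n * x) = expTwoPiI x ^ n := by
  rw [expTwoPiI, expTwoPiI, ← exp_nat_mul]
  ring_nf

theorem expTwoPiI_ne_zero (x : ℂ) : expTwoPiI x ≠ 0 := exp_ne_zero _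

theorem expTwoPiI_eq_one_iff (x : ℂ) : expTwoPiI x = 1 ↔ ∃ n : ℤ, x = n := by
  rw [expTwoPiI, exp_eq_one_iff]
  refine exists_congr fun n ↦ ?_
  rw [mul_comm (n : ℂ), mul_right_inj' two_pi_I_ne_zero]

theorem expTwoPiI_intCast (n : ℤ) : expTwoPiI n = 1 := (expTwoPiI_eq_one_iff _).mpr ⟨n, rfl⟩

theorem norm_expTwoPiI_lt_one {z : ℂ} (hz : 0 < z.im) : ‖expTwoPiI z‖ < 1 :=
  UpperHalfPlane.norm_exp_two_pi_I_lt_one ⟨z, hz⟩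

theorem sum_expTwoPiI_mul_div {p : ℕ} (hp : p ≠ 0) (N : ℕ) :
    ∑ j : Fin p, expTwoPiI (j * (N / p)) = if p ∣ N then (p : ℂ) else 0 := by
  have hp' : (p : ℂ) ≠ 0 := Nat.cast_ne_zero.mpr hp
  simp_rw [expTwoPiI_nat_mul]
  rw [Fin.sum_univ_eq_sum_range (fun j ↦ expTwoPiI (N / p) ^ j)]
  split_ifs with h
  · obtain ⟨k, rfl⟩ := h
    have : expTwoPiI ((p * k : ℕ) / p) = 1 := by
      rw [expTwoPiI_eq_one_iff]
      exact ⟨k, by push_cast; field_simp⟩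
    simp only [this, one_pow]
    simp
  · have h1 : expTwoPiI (N / p) ≠ 1 := by
      rw [Ne, expTwoPiI_eq_one_iff]
      rintro ⟨k, hk⟩
      rw [div_eq_iff hp'] at hk
      have hk' : (N : ℤ) = k * p := by exact_mod_cast hk
      exact h (Int.natCast_dvd_natCast.mp ⟨k, by rw [hk', mul_comm]⟩)
    rw [geom_sum_eq h1, ← expTwoPiI_nat_mul, mul_div_cancel₀ _ hp']
    have := expTwoPiI_intCast N
    rw [Int.cast_natCast] at this
    simp [this]

/-- The weight six slash action of an integer matrix, up to a power of the determinant. -/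
noncomputable def slash (M : Matrix (Fin 2) (Fin 2) ℤ) (f : ℂ → ℂ) (z : ℂ) : ℂ :=
  f ((M 0 0 * z + M 0 1) / (M 1 0 * z + M 1 1)) / (M 1 0 * z + M 1 1) ^ 6

/-- Representatives of the cosets making up the `p`-th Hecke operator. -/
def heckeRep (p : ℕ) : Option (Fin p) → Matrix (Fin 2) (Fin 2) ℤ
  | none => !![(p : ℤ), 0; 0, 1]
  | some j => !![1, 24 * (j : ℤ); 0, (p : ℤ)]

/-- The `p`-th Hecke operator in weight six, normalized so that
`hecke p f z = f (p z) + p⁻⁶ ∑ f ((z + 24 j) / p)`. -/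
noncomputable def hecke (p : ℕ) (f : ℂ → ℂ) (z : ℂ) : ℂ :=
  ∑ i : Option (Fin p), slash (heckeRep p i) f z

theorem hecke_eq (p : ℕ) (f : ℂ → ℂ) (z : ℂ) :
    hecke p f z = f (p * z) + ∑ j : Fin p, f ((z + 24 * j) / p) / p ^ 6 := by
  simp [hecke, slash, heckeRep, Fintype.sum_option]

/-- The action of the Hecke operator on the coefficients of a series
`∑ a n * exp (2πi (24 n + m) z / 24)`, where `D = m * (p - 1) / 24`. -/
noncomputable def heckeCoeff (p D : ℕ) (a : ℕ → ℂ) (n : ℕ) : ℂ :=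
  a (p * n + D) / p ^ 5 + if D ≤ n ∧ p ∣ n - D then a ((n - D) / p) else 0

theorem dvd_iff_mem_range {p m D N : ℕ} (hp : p.Prime) (hp5 : 5 ≤ p) (hDp : D < p)
    (hD : 24 * D + m = p * m) :
    p ∣ 24 * N + m ↔ N ∈ Set.range (p * · + D) := by
  constructor
  · intro h
    have h24 : Nat.Coprime p 24 := by
      rw [hp.coprime_iff_not_dvd, show 24 = 2 ^ 3 * 3 by norm_num, hp.dvd_mul]
      rintro (h | h)
      · have := Nat.le_of_dvd two_pos (hp.dvd_of_dvd_pow h)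
        lia
      · have := Nat.le_of_dvd three_pos h
        lia
    have h1 : 24 * N ≡ 24 * D [MOD p] := by
      refine Nat.ModEq.add_right_cancel' m ?_
      rw [hD]
      exact (Nat.modEq_zero_iff_dvd.mpr h).trans (Nat.modEq_zero_iff_dvd.mpr ⟨m, rfl⟩).symm
    have h2 : N % p = D := by
      rw [Nat.ModEq.cancel_left_of_coprime h24 h1, Nat.mod_eq_of_lt hDp]
    exact ⟨N / p, by simpa only [h2] using Nat.div_add_mod N p⟩
  · rintro ⟨n, rfl⟩
    exact ⟨24 * n + m, by simp only; linarith⟩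

theorem hasSum_hecke {a : ℕ → ℂ} {F : ℂ → ℂ} {m : ℕ}
    (hF : ∀ z : ℂ, 0 < z.im → HasSum (fun n : ℕ ↦ a n * expTwoPiI ((24 * n + m) / 24 * z)) (F z))
    {p D : ℕ} (hp : p.Prime) (hp5 : 5 ≤ p) (hDp : D < p) (hD : 24 * D + m = p * m)
    {z : ℂ} (hz : 0 < z.im) :
    HasSum (fun n : ℕ ↦ heckeCoeff p D a n * expTwoPiI ((24 * n + m) / 24 * z))
      (hecke p F z) := by
  have hp0 : (p : ℂ) ≠ 0 := Nat.cast_ne_zero.mpr hp.ne_zero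
  have hDC : (24 * D + m : ℂ) = p * m := by exact_mod_cast hD
  have hinj : Function.Injective (p * · + D) := fun x y h ↦ by
    simpa [hp.ne_zero] using h
  simp_rw [hecke_eq, heckeCoeff, add_mul, add_comm (F _)]
  refine HasSum.add ?_ ?_
  · have hsum : HasSum (fun N : ℕ ↦
        ∑ j : Fin p, a N * expTwoPiI ((24 * N + m) / 24 * ((z + 24 * j) / p)) / p ^ 6)
        (∑ j : Fin p, F ((z + 24 * j) / p) / p ^ 6) := by
      refine hasSum_sum fun j _ ↦ (hF _ ?_).div_const _
      have : ((z + 24 * j) / p).im = z.im / p := by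
        rw [div_natCast_im]
        simp
      rw [this]
      exact div_pos hz (Nat.cast_pos.mpr hp.pos)
    have hterm (N : ℕ) :
        ∑ j : Fin p, a N * expTwoPiI ((24 * N + m) / 24 * ((z + 24 * j) / p)) / p ^ 6 =
        a N * expTwoPiI ((24 * N + m) / 24 * z / p) *
          (if p ∣ 24 * N + m then (p : ℂ) else 0) / p ^ 6 := by
      rw [← sum_expTwoPiI_mul_div hp.ne_zero, Finset.mul_sum, Finset.sum_div]
      refine Finset.sum_congr rfl fun j _ ↦ ?_
      rw [mul_assoc (a N), ← expTwoPiI_add]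
      congr 3
      push_cast
      field_simp
    simp_rw [hterm] at hsum
    rw [← hinj.hasSum_iff] at hsum
    · refine hsum.congr_fun fun n ↦ ?_
      have hdvd : p ∣ 24 * (p * n + D) + m := (dvd_iff_mem_range hp hp5 hDp hD).mpr ⟨n, rfl⟩
      have harg : (24 * ((p * n + D : ℕ) : ℂ) + m) / 24 * z / p = (24 * n + m) / 24 * z := by
        push_cast
        field_simp
        linear_combination z * hDC
      simp only [Function.comp_apply]
      rw [if_pos hdvd, harg]
      field_simp
    · intro N hN
      rw [if_neg (fun h ↦ hN ((dvd_iff_mem_range hp hp5 hDp hD).mp h))]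
      simp
  · rw [← hinj.hasSum_iff]
    · refine (hF (p * z) (by simpa using mul_pos (Nat.cast_pos.mpr hp.pos) hz)).congr_fun fun l ↦ ?_
      have harg : (24 * ((p * l + D : ℕ) : ℂ) + m) / 24 * z = (24 * l + m) / 24 * (p * z) := by
        push_cast
        linear_combination z / 24 * hDC
      simp only [Function.comp_apply]
      rw [if_pos ⟨Nat.le_add_left _ _, by simp⟩, harg, Nat.add_sub_cancel,
        Nat.mul_div_cancel_left _ hp.pos]
    · intro n hn
      rw [if_neg, zero_mul]
      rintro ⟨h1, k, hk⟩
      exact hn ⟨k, by simp only; lia⟩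

end HeckeExpansion

section EtaQuotients

open Complex PowerSeries Filter Topology

/-- The eta quotient `η(z)ʳ η(2z)ˢ`. -/
noncomputable def etaQuotient (r s : ℕ) (z : ℂ) : ℂ :=
  ModularForm.eta z ^ r * ModularForm.eta (2 * z) ^ s

theorem eta_eq_expTwoPiI_mul (z : ℂ) :
    ModularForm.eta z = expTwoPiI (z / 24) * eulerProduct (expTwoPiI z) := by
  simp_rw [ModularForm.eta, ModularForm.eta_q_eq_pow, eulerProduct, expTwoPiI,
    Function.Periodic.qParam]
  push_cast
  ring_nf

theorem etaQuotient_eq (r s : ℕ) (z : ℂ) :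
    etaQuotient r s z = expTwoPiI (((r + 2 * s : ℕ) : ℂ) / 24 * z) *
      (eulerProduct (expTwoPiI z) ^ r * eulerProduct (expTwoPiI z ^ 2) ^ s) := by
  have h2 : expTwoPiI (2 * z) = expTwoPiI z ^ 2 := by exact_mod_cast expTwoPiI_nat_mul 2 z
  have h : ((r + 2 * s : ℕ) : ℂ) / 24 * z = r * (z / 24) + s * (2 * z / 24) := by
    push_cast
    ring
  rw [etaQuotient, eta_eq_expTwoPiI_mul, eta_eq_expTwoPiI_mul, h2, h, expTwoPiI_add,
    expTwoPiI_nat_mul, expTwoPiI_nat_mul]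
  ring

theorem etaQuotient_ne_zero (r s : ℕ) {z : ℂ} (hz : 0 < z.im) : etaQuotient r s z ≠ 0 :=
  mul_ne_zero (pow_ne_zero _ (ModularForm.eta_ne_zero hz))
    (pow_ne_zero _ (ModularForm.eta_ne_zero (by simpa using hz)))

theorem differentiableAt_etaQuotient (r s : ℕ) {z : ℂ} (hz : 0 < z.im) :
    DifferentiableAt ℂ (etaQuotient r s) z := by
  have h1 := ModularForm.differentiableAt_eta_of_mem_upperHalfPlaneSet hz
  have h2 : DifferentiableAt ℂ ModularForm.eta (2 * z) :=
    ModularForm.differentiableAt_eta_of_mem_upperHalfPlaneSet (by simpa using hz)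
  have h3 : DifferentiableAt ℂ (fun z ↦ ModularForm.eta (2 * z)) z :=
    h2.comp z (by fun_prop)
  exact (h1.pow r).mul (h3.pow s)

theorem hasSum_etaQuotient (r s : ℕ) {z : ℂ} (hz : 0 < z.im) :
    HasSum (fun n : ℕ ↦ coeff n (etaSeries ℂ r s) *
      expTwoPiI ((24 * n + (r + 2 * s : ℕ)) / 24 * z)) (etaQuotient r s z) := by
  rw [etaQuotient_eq]
  refine (((evaluatesTo_etaSeries r s _ (norm_expTwoPiI_lt_one hz)).2).mul_left
    (expTwoPiI (((r + 2 * s : ℕ) : ℂ) / 24 * z))).congr_fun fun n ↦ ?_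
  rw [show (24 * n + (r + 2 * s : ℕ)) / 24 * z =
    ((r + 2 * s : ℕ) : ℂ) / 24 * z + n * z by ring, expTwoPiI_add, expTwoPiI_nat_mul]
  ring

theorem exists_expTwoPiI_eq {q : ℂ} (hq : ‖q‖ < 1) (hq0 : q ≠ 0) :
    ∃ z : ℂ, 0 < z.im ∧ expTwoPiI z = q := by
  refine ⟨Function.Periodic.invQParam 1 q,
    Function.Periodic.im_invQParam_pos_of_norm_lt_one one_pos hq hq0, ?_⟩
  simpa [expTwoPiI, Function.Periodic.qParam] using
    Function.Periodic.qParam_right_inv one_ne_zero hq0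

/-- The quotient of a series `∑ b n * exp (2πi (24 n + m) z / 24)` by an eta quotient is a
quotient of power series in `exp (2πiz)`. -/
theorem hasSum_div_expTwoPiI {b : ℕ → ℂ} {H : ℂ → ℂ} {m : ℕ}
    (hH : ∀ z : ℂ, 0 < z.im → HasSum (fun n : ℕ ↦ b n * expTwoPiI ((24 * n + m) / 24 * z)) (H z))
    {z : ℂ} (hz : 0 < z.im) :
    HasSum (fun n : ℕ ↦ b n * expTwoPiI z ^ n) (H z / expTwoPiI (m / 24 * z)) := by
  refine ((hH z hz).div_const (expTwoPiI (m / 24 * z))).congr_fun fun n ↦ ?_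
  rw [show (24 * n + m) / 24 * z = (m : ℂ) / 24 * z + n * z by ring, expTwoPiI_add,
    expTwoPiI_nat_mul]
  field_simp [expTwoPiI_ne_zero]

theorem hasSum_pow_of_hasSum_expTwoPiI {b : ℕ → ℂ} {H : ℂ → ℂ} {m : ℕ}
    (hH : ∀ z : ℂ, 0 < z.im → HasSum (fun n : ℕ ↦ b n * expTwoPiI ((24 * n + m) / 24 * z)) (H z))
    {q : ℂ} (hq : ‖q‖ < 1) : HasSum (fun n : ℕ ↦ b n * q ^ n) (∑' n, b n * q ^ n) := by
  refine Summable.hasSum ?_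
  by_cases hq0 : q = 0
  · refine summable_of_ne_finset_zero (s := {0}) fun n hn ↦ ?_
    simp [hq0, zero_pow (by simpa using hn)]
  · obtain ⟨z, hz, rfl⟩ := exists_expTwoPiI_eq hq hq0
    exact (hasSum_div_expTwoPiI hH hz).summable

theorem hasFPowerSeriesAt_of_hasSum {b : ℕ → ℂ} {G : ℂ → ℂ}
    (hG : ∀ q : ℂ, ‖q‖ < 1 → HasSum (fun n : ℕ ↦ b n * q ^ n) (G q)) :
    HasFPowerSeriesAt G (FormalMultilinearSeries.ofScalars ℂ b) 0 := by
  rw [hasFPowerSeriesAt_iff]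
  filter_upwards [Metric.ball_mem_nhds (0 : ℂ) one_pos] with q hq
  simpa [mul_comm] using hG q (by simpa using hq)

/-- A power series in `exp (2πiz)` divided by another one with constant coefficient `1` is bounded
for large imaginary part. -/
theorem exists_norm_div_etaQuotient_le {b : ℕ → ℂ} {H : ℂ → ℂ} {r s : ℕ}
    (hH : ∀ z : ℂ, 0 < z.im →
      HasSum (fun n : ℕ ↦ b n * expTwoPiI ((24 * n + (r + 2 * s : ℕ)) / 24 * z)) (H z)) :
    ∃ M A : ℝ, 0 < A ∧ ∀ z : ℂ, A ≤ z.im → ‖H z / etaQuotient r s z‖ ≤ M := by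
  set G : ℂ → ℂ := fun q ↦ ∑' n, b n * q ^ n
  set P : ℂ → ℂ := fun q ↦ eulerProduct q ^ r * eulerProduct (q ^ 2) ^ s
  have hG := (hasFPowerSeriesAt_of_hasSum fun q hq ↦ hasSum_pow_of_hasSum_expTwoPiI hH hq)
  have hP := (hasFPowerSeriesAt_of_hasSum fun q hq ↦ (evaluatesTo_etaSeries r s q hq).2)
  have hP0 : P 0 ≠ 0 := by
    simp [P, eulerProduct]
  have hc : ContinuousAt (fun q ↦ G q / P q) 0 := hG.continuousAt.div hP.continuousAt hP0
  obtain ⟨M, hM⟩ := (hc.norm.isBoundedUnder_le)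
  rw [eventually_map, Metric.eventually_nhds_iff] at hM
  obtain ⟨ε, hε, hM⟩ := hM
  have hlim : Tendsto (fun y : ℝ ↦ Real.exp (-(2 * Real.pi * y))) atTop (𝓝 0) :=
    Real.tendsto_exp_neg_atTop_nhds_zero.comp
      (tendsto_id.const_mul_atTop (by positivity))
  obtain ⟨A, hA⟩ := eventually_atTop.mp (hlim.eventually (gt_mem_nhds hε))
  refine ⟨M, max A 1, by positivity, fun z hz ↦ ?_⟩
  have hz0 : 0 < z.im := one_pos.trans_le ((le_max_right _ _).trans hz)
  have hq : ‖expTwoPiI z‖ = Real.exp (-(2 * Real.pi * z.im)) := by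
    rw [expTwoPiI, norm_exp]
    simp
  have h := hM (y := expTwoPiI z) (by
    rw [dist_zero_right, hq]
    exact hA _ ((le_max_left _ _).trans hz))
  rw [etaQuotient_eq, ← div_div]
  rwa [← (hasSum_div_expTwoPiI hH hz0).tsum_eq]

/-- A series which is a constant multiple of an eta quotient has proportional coefficients. -/
theorem coeff_eq_of_eq_const_mul_etaQuotient {b : ℕ → ℂ} {H : ℂ → ℂ} {r s : ℕ} {κ : ℂ}
    (hH : ∀ z : ℂ, 0 < z.im →
      HasSum (fun n : ℕ ↦ b n * expTwoPiI ((24 * n + (r + 2 * s : ℕ)) / 24 * z)) (H z))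
    (h : ∀ z : ℂ, 0 < z.im → H z = κ * etaQuotient r s z) (n : ℕ) :
    b n = κ * coeff n (etaSeries ℂ r s) := by
  have hG := (hasFPowerSeriesAt_of_hasSum fun q hq ↦ hasSum_pow_of_hasSum_expTwoPiI hH hq)
  have hP := (hasFPowerSeriesAt_of_hasSum (b := fun n ↦ κ * coeff n (etaSeries ℂ r s))
    fun q hq ↦ by
      simpa [mul_assoc] using (evaluatesTo_etaSeries r s q hq).2.mul_left κ)
  have heq : ∀ᶠ q in 𝓝[≠] (0 : ℂ), (∑' n, b n * q ^ n) =
      κ * (eulerProduct q ^ r * eulerProduct (q ^ 2) ^ s) := by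
    filter_upwards [self_mem_nhdsWithin,
      nhdsWithin_le_nhds (Metric.ball_mem_nhds (0 : ℂ) one_pos)] with q hq0 hq
    obtain ⟨z, hz, rfl⟩ := exists_expTwoPiI_eq (by simpa using hq) hq0
    rw [(hasSum_div_expTwoPiI hH hz).tsum_eq, h z hz, etaQuotient_eq]
    field_simp [expTwoPiI_ne_zero]
  have hser := hG.eq_formalMultilinearSeries_of_eventually hP
    ((hG.analyticAt.frequently_eq_iff_eventually_eq hP.analyticAt).mp heq.frequently)
  simpa using congrArg (fun p ↦ p.coeff n) hser

end EtaQuotients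

section SlashAction

open Matrix

/-- The Möbius action of an integer matrix on the complex numbers. -/
noncomputable def moebius (M : Matrix (Fin 2) (Fin 2) ℤ) (z : ℂ) : ℂ :=
  (M 0 0 * z + M 0 1) / (M 1 0 * z + M 1 1)

theorem slash_eq (M : Matrix (Fin 2) (Fin 2) ℤ) (f : ℂ → ℂ) (z : ℂ) :
    slash M f z = f (moebius M z) / (M 1 0 * z + M 1 1) ^ 6 := rfl

theorem moebius_denom_ne_zero {M : Matrix (Fin 2) (Fin 2) ℤ} (hM : M.det ≠ 0) {z : ℂ}
    (hz : 0 < z.im) : (M 1 0 * z + M 1 1 : ℂ) ≠ 0 := by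
  intro h
  have him := congrArg Complex.im h
  have hre := congrArg Complex.re h
  simp only [Complex.add_im, Complex.mul_im, Complex.intCast_re, Complex.intCast_im, zero_mul,
    add_zero, Complex.zero_im, mul_eq_zero, hz.ne', or_false] at him
  simp only [Complex.add_re, Complex.mul_re, Complex.intCast_re, Complex.intCast_im, him, zero_mul,
    sub_zero, zero_add, Complex.zero_re] at hre
  rw [Matrix.det_fin_two] at hM
  have h0 : M 1 0 = 0 := by exact_mod_cast him
  have h1 : M 1 1 = 0 := by exact_mod_cast hre
  simp [h0, h1] at hM

theorem moebius_im_pos {M : Matrix (Fin 2) (Fin 2) ℤ} (hM : 0 < M.det) {z : ℂ}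
    (hz : 0 < z.im) : 0 < (moebius M z).im := by
  have hd := Complex.normSq_pos.mpr (moebius_denom_ne_zero hM.ne' hz)
  have him : (moebius M z).im = M.det * z.im / Complex.normSq (M 1 0 * z + M 1 1) := by
    rw [moebius, Complex.div_im, ← sub_div, Matrix.det_fin_two]
    congr 1
    simp
    ring
  rw [him]
  have : (0 : ℝ) < M.det := by exact_mod_cast hM
  positivity

theorem moebius_mul (M N : Matrix (Fin 2) (Fin 2) ℤ) (hN : N.det ≠ 0) {z : ℂ} (hz : 0 < z.im) :
    moebius (M * N) z = moebius M (moebius N z) := by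
  have hd := moebius_denom_ne_zero hN hz
  rw [moebius, moebius, ← div_div_div_cancel_right₀ hd]
  simp only [Matrix.mul_apply, Fin.sum_univ_two, moebius]
  push_cast
  congr 1 <;> field_simp <;> ring

theorem slash_mul (M N : Matrix (Fin 2) (Fin 2) ℤ) (hN : N.det ≠ 0) (f : ℂ → ℂ) {z : ℂ}
    (hz : 0 < z.im) : slash (M * N) f z = slash N (slash M f) z := by
  have hd := moebius_denom_ne_zero hN hz
  rw [slash_eq, slash_eq, slash_eq, moebius_mul M N hN hz, div_div, ← mul_pow]
  congr 2
  simp only [Matrix.mul_apply, Fin.sum_univ_two, moebius]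
  push_cast
  field_simp
  ring

theorem slash_congr {M : Matrix (Fin 2) (Fin 2) ℤ} (hM : 0 < M.det) {f g : ℂ → ℂ}
    (hfg : ∀ z : ℂ, 0 < z.im → f z = g z) {z : ℂ} (hz : 0 < z.im) :
    slash M f z = slash M g z := by
  rw [slash_eq, slash_eq, hfg _ (moebius_im_pos hM hz)]

theorem slash_sum {ι : Type*} (s : Finset ι) (M : Matrix (Fin 2) (Fin 2) ℤ) (f : ι → ℂ → ℂ)
    (z : ℂ) : slash M (fun w ↦ ∑ i ∈ s, f i w) z = ∑ i ∈ s, slash M (f i) z := by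
  simp only [slash_eq, Finset.sum_div]

/-- Integer matrices of determinant `k` congruent to the identity modulo `24`, with lower left
entry divisible by `48`. -/
def congruenceMatrices (k : ℤ) : Set (Matrix (Fin 2) (Fin 2) ℤ) :=
  {M | M.det = k ∧ 24 ∣ M 0 0 - 1 ∧ 24 ∣ M 0 1 ∧ 48 ∣ M 1 0 ∧ 24 ∣ M 1 1 - 1}

/-- Conjugation by `N`, in either direction, preserves each of the sets `congruenceMatrices k`. -/
structure NormalizesCongruence (N : Matrix (Fin 2) (Fin 2) ℤ) : Prop where
  det_pos : 0 < N.det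
  exists_mul_eq {k : ℤ} {M : Matrix (Fin 2) (Fin 2) ℤ} (hM : M ∈ congruenceMatrices k) :
    ∃ X ∈ congruenceMatrices k, M * N = N * X
  exists_eq_mul {k : ℤ} {M : Matrix (Fin 2) (Fin 2) ℤ} (hM : M ∈ congruenceMatrices k) :
    ∃ X ∈ congruenceMatrices k, N * M = X * N

theorem conj_mem_congruenceMatrices {a b c d k : ℤ} (hdet : a * d - b * c = 1) (hc : 2 ∣ c)
    {M : Matrix (Fin 2) (Fin 2) ℤ} (hM : M ∈ congruenceMatrices k) :
    !![d, -b; -c, a] * M * !![a, b; c, d] ∈ congruenceMatrices k := by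
  obtain ⟨h0, ⟨x, hx⟩, ⟨y, hy⟩, ⟨u, hu⟩, ⟨v, hv⟩⟩ := hM
  obtain ⟨e, rfl⟩ := hc
  have hx' : M 0 0 = 24 * x + 1 := by lia
  have hv' : M 1 1 = 24 * v + 1 := by lia
  refine ⟨?_, ?_⟩
  · rw [Matrix.det_mul, Matrix.det_mul, Matrix.det_fin_two_of, Matrix.det_fin_two_of, h0]
    linear_combination (a * d - b * (2 * e) + 1) * k * hdet
  · simp only [Matrix.mul_apply, Fin.sum_univ_two, Matrix.of_apply, Matrix.cons_val',
      Matrix.cons_val_zero, Matrix.cons_val_one, Matrix.cons_val_fin_one, hx', hy, hu, hv']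
    refine ⟨⟨d * (a * x + 2 * e * y) - b * (a * (2 * u) + 2 * e * v), ?_⟩,
      ⟨d * (b * x + d * y) - b * (b * (2 * u) + d * v), ?_⟩,
      ⟨-e * (a * x + 2 * e * y) + a * (a * u + e * v), ?_⟩,
      ⟨-(2 * e) * (b * x + d * y) + a * (b * (2 * u) + d * v), ?_⟩⟩
    · linear_combination hdet
    · ring
    · ring
    · linear_combination hdet

theorem normalizesCongruence_of_det_eq_one {N : Matrix (Fin 2) (Fin 2) ℤ} (hdet : N.det = 1)
    (hc : 2 ∣ N 1 0) : NormalizesCongruence N := by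
  obtain ⟨a, b, c, d, rfl⟩ : ∃ a b c d, N = !![a, b; c, d] := ⟨_, _, _, _, Matrix.eta_fin_two N⟩
  rw [Matrix.det_fin_two_of] at hdet
  have hc' : 2 ∣ c := by simpa using hc
  have h1 : !![a, b; c, d] * !![d, -b; -c, a] = 1 := by
    have := Matrix.mul_adjugate !![a, b; c, d]
    rwa [Matrix.adjugate_fin_two_of, Matrix.det_fin_two_of, hdet, one_smul] at this
  have h2 : !![d, -b; -c, a] * !![a, b; c, d] = 1 := mul_eq_one_comm.mp h1
  refine ⟨by rw [Matrix.det_fin_two_of, hdet]; exact one_pos, fun {k M} hM ↦ ?_, fun {k M} hM ↦ ?_⟩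
  · refine ⟨_, conj_mem_congruenceMatrices hdet hc' hM, ?_⟩
    rw [← mul_assoc, ← mul_assoc, h1, one_mul]
  · refine ⟨_, conj_mem_congruenceMatrices (a := d) (b := -b) (c := -c) (d := a)
      (by linear_combination hdet) (by simpa using hc') hM, ?_⟩
    rw [mul_assoc, h2, mul_one, neg_neg, neg_neg]

/-- The matrix of the Fricke involution `z ↦ -1 / (2z)`. -/
def fricke : Matrix (Fin 2) (Fin 2) ℤ := !![0, -1; 2, 0]

theorem normalizesCongruence_fricke : NormalizesCongruence fricke := by
  have key {k : ℤ} {M : Matrix (Fin 2) (Fin 2) ℤ} (hM : M ∈ congruenceMatrices k) :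
      ∃ X ∈ congruenceMatrices k, M * fricke = fricke * X ∧ fricke * M = X * fricke := by
    obtain ⟨h0, h1, ⟨y, hy⟩, ⟨u, hu⟩, h4⟩ := hM
    obtain ⟨a, b, c, d, rfl⟩ : ∃ a b c d, M = !![a, b; c, d] :=
      ⟨_, _, _, _, Matrix.eta_fin_two M⟩
    rw [Matrix.det_fin_two_of] at h0
    simp only [Matrix.of_apply, Matrix.cons_val', Matrix.cons_val_zero,
      Matrix.cons_val_one, Matrix.cons_val_fin_one] at h1 hy hu h4
    subst hy hu
    refine ⟨!![d, -(24 * u); -(48 * y), a], ⟨?_, by simpa, by simp, by simp, by simpa⟩, ?_, ?_⟩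
    · rw [Matrix.det_fin_two_of]
      linear_combination h0
    · simp [fricke]
      ring_nf
      simp
    · simp [fricke]
      ring_nf
      simp
  refine ⟨by simp [fricke], fun hM ↦ ?_, fun hM ↦ ?_⟩
  · obtain ⟨X, hX, h, -⟩ := key hM
    exact ⟨X, hX, h⟩
  · obtain ⟨X, hX, -, h⟩ := key hM
    exact ⟨X, hX, h⟩

theorem heckeRep_mem_congruenceMatrices {p : ℕ} (hp : p % 24 = 1) (i : Option (Fin p)) :
    heckeRep p i ∈ congruenceMatrices p := by
  have : (24 : ℤ) ∣ p - 1 := by lia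
  cases i <;> simpa [congruenceMatrices, heckeRep]

theorem eq_of_heckeRep_eq_mul {p : ℕ} (hp : p.Prime) (hp1 : p % 24 = 1) {i k : Option (Fin p)}
    {D : Matrix (Fin 2) (Fin 2) ℤ} (h : heckeRep p i = D * heckeRep p k) : i = k := by
  have hunit (x : ℤ) : (p : ℤ) * x ≠ 1 := fun hx ↦
    hp.one_lt.ne' (by simpa using Int.isUnit_iff_natAbs_eq.mp (IsUnit.of_mul_eq_one x hx))
  have h00 := congrFun (congrFun h 0) 0
  have h01 := congrFun (congrFun h 0) 1
  have h10 := congrFun (congrFun h 1) 0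
  have h11 := congrFun (congrFun h 1) 1
  rcases i with _ | i <;> rcases k with _ | k <;>
    simp [heckeRep, Matrix.mul_apply, Fin.sum_univ_two] at h00 h01 h10 h11
  · rfl
  · rw [← h10] at h11
    exact absurd (by linear_combination -h11) (hunit (D 1 1))
  · exact absurd (by linear_combination -h00) (hunit (D 0 0))
  · rw [← h00] at h01
    have hdvd : (p : ℤ) ∣ 24 * ((i : ℤ) - k) := ⟨D 0 1, by linear_combination h01⟩
    have hcop : IsCoprime (p : ℤ) 24 := ⟨1, -((p / 24 : ℕ) : ℤ), by lia⟩
    have := Int.eq_zero_of_abs_lt_dvd (hcop.dvd_of_dvd_mul_left hdvd)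
      (by have := i.isLt; have := k.isLt; rw [abs_lt]; omega)
    congr 1
    ext
    omega

theorem exists_eq_mul_heckeRep {p : ℕ} (hp : p.Prime) (hp1 : p % 24 = 1)
    {X : Matrix (Fin 2) (Fin 2) ℤ} (hX : X ∈ congruenceMatrices p) :
    ∃ i, ∃ D ∈ congruenceMatrices 1, X = D * heckeRep p i := by
  have _ : Fact p.Prime := ⟨hp⟩
  have hp0 : (p : ℤ) ≠ 0 := Nat.cast_ne_zero.mpr hp.ne_zero
  have hcop : IsCoprime (24 : ℤ) p := ⟨-((p / 24 : ℕ) : ℤ), 1, by lia⟩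
  have hcop' : IsCoprime (48 : ℤ) p := by
    have : IsCoprime (2 : ℤ) p := hcop.of_isCoprime_of_dvd_left ⟨12, by norm_num⟩
    exact (show (48 : ℤ) = 2 * 24 by norm_num) ▸ this.mul_left hcop
  obtain ⟨h0, h1, h2, h3, h4⟩ := hX
  obtain ⟨a, b, c, d, rfl⟩ : ∃ a b c d, X = !![a, b; c, d] := ⟨_, _, _, _, Matrix.eta_fin_two X⟩
  rw [Matrix.det_fin_two_of] at h0
  simp only [Matrix.of_apply, Matrix.cons_val', Matrix.cons_val_zero,
    Matrix.cons_val_one, Matrix.cons_val_fin_one] at h1 h2 h3 h4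
  by_cases hac : (p : ℤ) ∣ a ∧ (p : ℤ) ∣ c
  · obtain ⟨⟨a, rfl⟩, ⟨c, rfl⟩⟩ := hac
    refine ⟨none, !![a, b; c, d], ⟨?_, ?_, ?_, ?_, ?_⟩, ?_⟩
    · rw [Matrix.det_fin_two_of]
      exact mul_left_cancel₀ hp0 (by linear_combination h0)
    · have : (24 : ℤ) ∣ (p - 1) * a := Dvd.dvd.mul_right (by lia) _
      simpa using (dvd_sub h1 this).trans (dvd_of_eq (by ring : _ = a - 1))
    · simpa using h2
    · simpa using hcop'.dvd_of_dvd_mul_left h3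
    · simpa using h4
    · simp [heckeRep, mul_comm]
  · obtain ⟨x, hx1, hx2⟩ : ∃ x : ZMod p, (b : ZMod p) = 24 * x * a ∧ (d : ZMod p) = 24 * x * c := by
      have h0' : (a : ZMod p) * d - b * c = 0 := by
        have := congrArg (Int.cast : ℤ → ZMod p) h0
        simpa using this
      have h24 : (24 : ZMod p) ≠ 0 := by
        intro h
        have : (p : ℤ) ∣ 24 := (ZMod.intCast_zmod_eq_zero_iff_dvd 24 p).mp (by exact_mod_cast h)
        have := Int.isUnit_iff_natAbs_eq.mp (hcop.isUnit_of_dvd' this dvd_rfl)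
        exact hp.one_lt.ne' (by simpa using this)
      by_cases ha : (a : ZMod p) = 0
      · have hc : (c : ZMod p) ≠ 0 := fun hc ↦ hac
          ⟨(ZMod.intCast_zmod_eq_zero_iff_dvd _ _).mp ha,
            (ZMod.intCast_zmod_eq_zero_iff_dvd _ _).mp hc⟩
        refine ⟨d / (24 * c), ?_, ?_⟩ <;> field_simp
        linear_combination -h0'
      · refine ⟨b / (24 * a), ?_, ?_⟩ <;> field_simp
        linear_combination h0'
    have hxj : ((x.val : ℤ) : ZMod p) = x := by simp
    obtain ⟨y, hy⟩ : (p : ℤ) ∣ b - 24 * x.val * a := by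
      rw [← ZMod.intCast_zmod_eq_zero_iff_dvd]
      push_cast
      rw [← Int.cast_natCast, hxj, hx1, sub_self]
    obtain ⟨w, hw⟩ : (p : ℤ) ∣ d - 24 * x.val * c := by
      rw [← ZMod.intCast_zmod_eq_zero_iff_dvd]
      push_cast
      rw [← Int.cast_natCast, hxj, hx2, sub_self]
    refine ⟨some ⟨x.val, ZMod.val_lt x⟩, !![a, y; c, w], ⟨?_, ?_, ?_, ?_, ?_⟩, ?_⟩
    · rw [Matrix.det_fin_two_of]
      exact mul_left_cancel₀ hp0 (by linear_combination h0 - a * hw + c * hy)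
    · simpa using h1
    · simpa using hcop.dvd_of_dvd_mul_left
        (hy ▸ dvd_sub h2 ((dvd_mul_right 24 _).mul_right _))
    · simpa using h3
    · have : (24 : ℤ) ∣ (p - 1) * w := Dvd.dvd.mul_right (by lia) _
      have := dvd_sub h4 (this.add (((dvd_mul_right 24 (x.val : ℤ)).mul_right c)))
      simpa using this.trans (dvd_of_eq (by linear_combination hw : _ = w - 1))
    · ext i j
      fin_cases i <;> fin_cases j <;>
        simp [heckeRep, Matrix.mul_apply, Fin.sum_univ_two, -ZMod.natCast_val]
      · linear_combination hy
      · linear_combination hw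

/-- The Hecke operator commutes with the slash action of matrices normalizing the group under which
`f` is invariant. -/
theorem slash_hecke {p : ℕ} (hp : p.Prime) (hp1 : p % 24 = 1) {f : ℂ → ℂ}
    (hf : ∀ D ∈ congruenceMatrices 1, ∀ z : ℂ, 0 < z.im → slash D f z = f z)
    {N : Matrix (Fin 2) (Fin 2) ℤ} (hN : NormalizesCongruence N) {z : ℂ} (hz : 0 < z.im) :
    slash N (hecke p f) z = hecke p (slash N f) z := by
  have hex (i : Option (Fin p)) : ∃ k, ∃ D ∈ congruenceMatrices 1,
      heckeRep p i * N = D * (N * heckeRep p k) := by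
    obtain ⟨X, hX, hXN⟩ := hN.exists_mul_eq (heckeRep_mem_congruenceMatrices hp1 i)
    obtain ⟨k, D, hD, rfl⟩ := exists_eq_mul_heckeRep hp hp1 hX
    obtain ⟨D', hD', hDN⟩ := hN.exists_eq_mul hD
    exact ⟨k, D', hD', by rw [hXN, ← mul_assoc, hDN, mul_assoc]⟩
  choose σ D hD hσ using hex
  have hinj : Function.Injective σ := fun i k hik ↦ by
    have h1 : heckeRep p i * N = D i * (D k).adjugate * heckeRep p k * N := by
      rw [mul_assoc _ _ N, hσ k, mul_assoc, ← mul_assoc (D k).adjugate, Matrix.adjugate_mul,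
        (hD k).1, one_smul, one_mul, ← hik, hσ i]
    have h2 := congrArg (· * N.adjugate) h1
    simp only [mul_assoc _ N, Matrix.mul_adjugate, Matrix.mul_smul, mul_one] at h2
    exact eq_of_heckeRep_eq_mul hp hp1 (smul_right_injective _ hN.det_pos.ne' h2)
  have hdet (i : Option (Fin p)) : 0 < (heckeRep p i).det := by
    rw [(heckeRep_mem_congruenceMatrices hp1 i).1]
    exact Nat.cast_pos.mpr hp.pos
  have hterm (i : Option (Fin p)) :
      slash N (slash (heckeRep p i) f) z = slash (heckeRep p (σ i)) (slash N f) z := by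
    have hdet' : 0 < (N * heckeRep p (σ i)).det := by
      rw [Matrix.det_mul]
      exact mul_pos hN.det_pos (hdet _)
    rw [← slash_mul _ _ hN.det_pos.ne' _ hz, hσ, slash_mul _ _ hdet'.ne' _ hz,
      slash_congr hdet' (hf _ (hD i)) hz, slash_mul _ _ (hdet _).ne' _ hz]
  have hsum : slash N (hecke p f) z = ∑ i, slash N (slash (heckeRep p i) f) z := slash_sum _ _ _ _
  rw [hsum, Finset.sum_congr rfl fun i _ ↦ hterm i]
  exact Function.Bijective.sum_comp (Finite.injective_iff_bijective.mp hinj)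
    fun k ↦ slash (heckeRep p k) (slash N f) z

end SlashAction

section Transformation

open Matrix

theorem expTwoPiI_div_congr {x y : ℤ} (h : (24 : ℤ) ∣ x - y) :
    expTwoPiI (x / 24) = expTwoPiI (y / 24) := by
  obtain ⟨k, hk⟩ := h
  have : (x : ℂ) / 24 = y / 24 + k := by
    rw [show x = y + 24 * k by lia]
    push_cast
    ring
  rw [this, expTwoPiI_add, expTwoPiI_intCast, mul_one]

theorem etaQuotient_add_int (r s : ℕ) (k : ℤ) (z : ℂ) :
    etaQuotient r s (z + k) = expTwoPiI (((r + 2 * s) * k : ℤ) / 24) * etaQuotient r s z := by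
  rw [etaQuotient_eq, etaQuotient_eq, expTwoPiI_add z, expTwoPiI_intCast, mul_one, mul_add,
    expTwoPiI_add]
  push_cast
  ring_nf

theorem etaQuotient_neg_one_div_two_mul {r s : ℕ} (hrs : r + s = 12) {z : ℂ} (hz : 0 < z.im) :
    etaQuotient r s (-1 / (2 * z)) = -(Complex.sqrt 2) ^ r * z ^ 6 * etaQuotient s r z := by
  have hz0 : z ≠ 0 := fun h ↦ by simp [h] at hz
  have heta {w : ℂ} (hw : 0 < w.im) : ModularForm.eta (-1 / w) =
      (Complex.sqrt Complex.I)⁻¹ * (Complex.sqrt w * ModularForm.eta w) :=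
    ModularForm.eta_comp_eq_csqrt_I_inv hw
  have hsq (w : ℂ) : Complex.sqrt w ^ 2 = w := by
    simp [Complex.sqrt]
  have h2 : Complex.sqrt (2 * z) = Complex.sqrt 2 * Complex.sqrt z := by
    have hlog := Complex.log_ofReal_mul two_pos hz0
    rw [sqrt_eq_exp (by simpa using hz0), sqrt_eq_exp two_ne_zero, sqrt_eq_exp hz0,
      ← Complex.exp_add, ← add_div, ← Complex.ofReal_ofNat, hlog,
      Complex.ofReal_log zero_le_two]
  have hI : (Complex.sqrt Complex.I)⁻¹ ^ 12 = -1 := by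
    rw [show 12 = 2 * 6 by rfl, pow_mul, inv_pow, hsq, inv_pow, Complex.I_pow_eq_pow_mod]
    norm_num
  have h12 : Complex.sqrt z ^ 12 = z ^ 6 := by
    rw [show 12 = 2 * 6 by rfl, pow_mul, hsq]
  rw [etaQuotient, etaQuotient, show 2 * (-1 / (2 * z)) = -1 / z by field_simp, heta hz,
    heta (by simpa using hz), h2]
  simp only [mul_pow]
  rw [← h12]
  rw [← hrs] at hI ⊢
  rw [pow_add] at hI ⊢
  linear_combination Complex.sqrt 2 ^ r * Complex.sqrt z ^ r * Complex.sqrt z ^ s *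
    ModularForm.eta (2 * z) ^ r * ModularForm.eta z ^ s * hI

theorem slash_fricke_etaQuotient {r s : ℕ} (hrs : r + s = 12) {z : ℂ} (hz : 0 < z.im) :
    slash fricke (etaQuotient r s) z = -(Complex.sqrt 2) ^ r / 64 * etaQuotient s r z := by
  have hz0 : z ≠ 0 := fun h ↦ by simp [h] at hz
  have : moebius fricke z = -1 / (2 * z) := by simp [moebius, fricke]
  rw [slash_eq, this, etaQuotient_neg_one_div_two_mul hrs hz]
  simp [fricke]
  field_simp
  ring

theorem slash_const_mul (M : Matrix (Fin 2) (Fin 2) ℤ) (c : ℂ) (f : ℂ → ℂ) (z : ℂ) :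
    slash M (fun w ↦ c * f w) z = c * slash M f z := by
  rw [slash_eq, slash_eq, mul_div_assoc]

theorem slash_translation_etaQuotient (r s : ℕ) (k : ℤ) (z : ℂ) :
    slash !![1, k; 0, 1] (etaQuotient r s) z =
      expTwoPiI (((r + 2 * s) * k : ℤ) / 24) * etaQuotient r s z := by
  rw [← etaQuotient_add_int]
  simp [slash_eq, moebius]

theorem slash_lower_etaQuotient (k : ℤ) {z : ℂ} (hz : 0 < z.im) :
    slash !![1, 0; 2 * k, 1] (etaQuotient 11 1) z =
      expTwoPiI (k / 24) * etaQuotient 11 1 z := by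
  have hdetF : fricke.det ≠ 0 := normalizesCongruence_fricke.det_pos.ne'
  have hmul : !![1, 0; 2 * k, 1] * fricke = fricke * !![1, -k; 0, 1] := by
    simp [fricke]
  have hW {w : ℂ} (hw : 0 < w.im) :
      slash fricke (slash !![1, 0; 2 * k, 1] (etaQuotient 11 1)) w =
        expTwoPiI (k / 24) * slash fricke (etaQuotient 11 1) w := by
    rw [← slash_mul _ _ hdetF _ hw, hmul, slash_mul _ _ (by simp) _ hw,
      slash_congr (by simp) (fun z hz ↦ slash_fricke_etaQuotient (r := 11) (s := 1) rfl hz) hw,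
      slash_fricke_etaQuotient rfl hw, slash_const_mul, slash_translation_etaQuotient,
      expTwoPiI_div_congr (y := k) ⟨-k, by push_cast; ring⟩]
    ring
  have hinv : moebius fricke (moebius fricke z) = z := by
    have hz0 : z ≠ 0 := fun h ↦ by simp [h] at hz
    simp [moebius, fricke]
    field_simp
  have him := moebius_im_pos normalizesCongruence_fricke.det_pos hz
  have h := hW him
  rw [slash_eq, slash_eq fricke, hinv, mul_div_assoc'] at h
  exact (div_left_inj' (pow_ne_zero _ (moebius_denom_ne_zero hdetF him))).mp h

/-- The exponent of the multiplier of `η(z)¹¹ η(2z)` at `!![a, b; 2s, 2e + 1]`. -/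
def etaExponent (a b s e : ℤ) : ℤ :=
  -(a + (2 * e + 1)) * s + b * (2 * e + 1) * (2 * s ^ 2 + 13) + 3 * s * (2 * e + 1)
    + 6 * e * (e + 1)

theorem dvd_etaExponent_translation {a b s e : ℤ} (h : a * (2 * e + 1) - 2 * b * s = 1) :
    24 ∣ etaExponent a (a + b) s (e + s) - (etaExponent a b s e + 13) := by
  have h3 : (3 : ℤ) ∣ etaExponent a (a + b) s (e + s) - (etaExponent a b s e + 13) := by
    have h' := congrArg (Int.cast : ℤ → ZMod 3) h
    refine (ZMod.intCast_zmod_eq_zero_iff_dvd _ 3).mp ?_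
    simp only [etaExponent]
    push_cast at h' ⊢
    generalize (a : ZMod 3) = a, (b : ZMod 3) = b, (s : ZMod 3) = s, (e : ZMod 3) = e at *
    decide +revert
  have h8 : (8 : ℤ) ∣ etaExponent a (a + b) s (e + s) - (etaExponent a b s e + 13) := by
    have h' := congrArg (Int.cast : ℤ → ZMod 8) h
    refine (ZMod.intCast_zmod_eq_zero_iff_dvd _ 8).mp ?_
    simp only [etaExponent]
    push_cast at h' ⊢
    generalize (a : ZMod 8) = a, (b : ZMod 8) = b, (s : ZMod 8) = s, (e : ZMod 8) = e at *
    have ha : a = (2 * e + 1) * (1 + 2 * b * s) := by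
      have : (2 * e + 1) ^ 2 = 1 := by decide +revert
      linear_combination (2 * e + 1) * h' - a * this
    subst ha
    clear h'
    decide +revert
  lia

theorem dvd_etaExponent_lower {a b s e : ℤ} (h : a * (2 * e + 1) - 2 * b * s = 1) :
    24 ∣ etaExponent (a + 2 * b) b (s + (2 * e + 1)) e - (etaExponent a b s e + 1) := by
  have h3 : (3 : ℤ) ∣ etaExponent (a + 2 * b) b (s + (2 * e + 1)) e - (etaExponent a b s e + 1) := by
    have h' := congrArg (Int.cast : ℤ → ZMod 3) h
    refine (ZMod.intCast_zmod_eq_zero_iff_dvd _ 3).mp ?_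
    simp only [etaExponent]
    push_cast at h' ⊢
    generalize (a : ZMod 3) = a, (b : ZMod 3) = b, (s : ZMod 3) = s, (e : ZMod 3) = e at *
    decide +revert
  have h8 : (8 : ℤ) ∣ etaExponent (a + 2 * b) b (s + (2 * e + 1)) e - (etaExponent a b s e + 1) := by
    have h' := congrArg (Int.cast : ℤ → ZMod 8) h
    refine (ZMod.intCast_zmod_eq_zero_iff_dvd _ 8).mp ?_
    simp only [etaExponent]
    push_cast at h' ⊢
    generalize (a : ZMod 8) = a, (b : ZMod 8) = b, (s : ZMod 8) = s, (e : ZMod 8) = e at *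
    have ha : a = (2 * e + 1) * (1 + 2 * b * s) := by
      have : (2 * e + 1) ^ 2 = 1 := by decide +revert
      linear_combination (2 * e + 1) * h' - a * this
    subst ha
    clear h'
    decide +revert
  lia

theorem slash_mul_eq_const_mul {M N : Matrix (Fin 2) (Fin 2) ℤ} (hN : 0 < N.det) {f : ℂ → ℂ}
    {x y : ℂ} (hMf : ∀ z : ℂ, 0 < z.im → slash M f z = x * f z)
    (hNf : ∀ z : ℂ, 0 < z.im → slash N f z = y * f z) {z : ℂ} (hz : 0 < z.im) :
    slash (M * N) f z = x * y * f z := by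
  rw [slash_mul _ _ hN.ne' _ hz, slash_congr hN hMf hz, slash_const_mul, hNf z hz, mul_assoc]

theorem slash_etaQuotient {a b s e : ℤ} (h : a * (2 * e + 1) - 2 * b * s = 1) {z : ℂ}
    (hz : 0 < z.im) :
    slash !![a, b; 2 * s, 2 * e + 1] (etaQuotient 11 1) z =
      expTwoPiI (etaExponent a b s e / 24) * etaQuotient 11 1 z := by
  induction hk : (2 * s).natAbs + (2 * e + 1).natAbs using Nat.strong_induction_on
    generalizing a b s e z with
  | _ k ih
  have translation (ε : ℤ) (hε : ε = 1 ∨ ε = -1)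
      (hlt : (2 * (e + ε * s) + 1).natAbs < (2 * e + 1).natAbs) :
      slash !![a, b; 2 * s, 2 * e + 1] (etaQuotient 11 1) z =
        expTwoPiI (etaExponent a b s e / 24) * etaQuotient 11 1 z := by
    have hdet : a * (2 * (e + ε * s) + 1) - 2 * (b + ε * a) * s = 1 := by linear_combination h
    have hmul : !![a, b; 2 * s, 2 * e + 1] =
        !![a, b + ε * a; 2 * s, 2 * (e + ε * s) + 1] * !![1, -ε; 0, 1] := by
      rw [Matrix.mul_fin_two]
      ring_nf
    have hE : 24 ∣ (etaExponent a (b + ε * a) s (e + ε * s) + 13 * -ε) - etaExponent a b s e := by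
      rcases hε with rfl | rfl
      · convert dvd_etaExponent_translation h using 1
        ring_nf
      · obtain ⟨k, hk⟩ := dvd_etaExponent_translation hdet
        refine ⟨-k, ?_⟩
        simp only [etaExponent] at hk ⊢
        linear_combination -hk
    rw [hmul, slash_mul_eq_const_mul (by simp) (fun w hw ↦ ih _ (by lia) hdet hw rfl)
      (fun w _ ↦ slash_translation_etaQuotient 11 1 (-ε) w) hz, ← expTwoPiI_add, ← add_div,
      ← Int.cast_add, expTwoPiI_div_congr (by simpa using hE)]
  have lower (ε : ℤ) (hε : ε = 1 ∨ ε = -1)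
      (hlt : (2 * (s + ε * (2 * e + 1))).natAbs < (2 * s).natAbs) :
      slash !![a, b; 2 * s, 2 * e + 1] (etaQuotient 11 1) z =
        expTwoPiI (etaExponent a b s e / 24) * etaQuotient 11 1 z := by
    have hdet : (a + ε * (2 * b)) * (2 * e + 1) - 2 * b * (s + ε * (2 * e + 1)) = 1 := by
      linear_combination h
    have hmul : !![a, b; 2 * s, 2 * e + 1] =
        !![a + ε * (2 * b), b; 2 * (s + ε * (2 * e + 1)), 2 * e + 1] * !![1, 0; 2 * -ε, 1] := by
      rw [Matrix.mul_fin_two]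
      ring_nf
    have hE : 24 ∣ (etaExponent (a + ε * (2 * b)) b (s + ε * (2 * e + 1)) e + -ε) -
        etaExponent a b s e := by
      rcases hε with rfl | rfl
      · convert dvd_etaExponent_lower h using 1
        ring_nf
      · obtain ⟨k, hk⟩ := dvd_etaExponent_lower hdet
        refine ⟨-k, ?_⟩
        simp only [etaExponent] at hk ⊢
        linear_combination -hk
    rw [hmul, slash_mul_eq_const_mul (by simp) (fun w hw ↦ ih _ (by lia) hdet hw rfl)
      (fun w hw ↦ slash_lower_etaQuotient (-ε) hw) hz, ← expTwoPiI_add, ← add_div,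
      ← Int.cast_add, expTwoPiI_div_congr hE]
  obtain rfl | hs := eq_or_ne s 0
  · rw [mul_zero, sub_zero] at h
    rcases Int.eq_one_or_neg_one_of_mul_eq_one' h with ⟨rfl, he⟩ | ⟨rfl, he⟩
    · obtain rfl : e = 0 := by lia
      have := slash_translation_etaQuotient 11 1 b z
      simpa [etaExponent, mul_comm] using this
    · obtain rfl : e = -1 := by lia
      have hmoebius : moebius !![-1, b; 2 * 0, 2 * -1 + 1] z = z + (-b : ℤ) := by
        simp [moebius]
        ring
      rw [slash_eq, hmoebius, etaQuotient_add_int]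
      norm_num [etaExponent, mul_comm]
  · by_cases hlt : (2 * s).natAbs < (2 * e + 1).natAbs
    · by_cases hse : 0 < s * (2 * e + 1)
      · refine translation (-1) (.inr rfl) ?_
        rcases pos_and_pos_or_neg_and_neg_of_mul_pos hse with h | h <;> lia
      · refine translation 1 (.inl rfl) ?_
        rcases hs.lt_or_gt with h | h
        · have : 0 ≤ 2 * e + 1 := by nlinarith
          lia
        · have : 2 * e + 1 ≤ 0 := by nlinarith
          lia
    · by_cases hse : 0 < s * (2 * e + 1)
      · refine lower (-1) (.inr rfl) ?_
        rcases pos_and_pos_or_neg_and_neg_of_mul_pos hse with h | h <;> lia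
      · refine lower 1 (.inl rfl) ?_
        rcases hs.lt_or_gt with h | h
        · have : 0 ≤ 2 * e + 1 := by nlinarith
          lia
        · have : 2 * e + 1 ≤ 0 := by nlinarith
          lia

theorem exists_slash_etaQuotient {M : Matrix (Fin 2) (Fin 2) ℤ} (hM : M.det = 1)
    (hc : 2 ∣ M 1 0) :
    ∃ c ≠ 0, ∀ z : ℂ, 0 < z.im → slash M (etaQuotient 11 1) z = c * etaQuotient 11 1 z := by
  obtain ⟨a, b, c, d, rfl⟩ : ∃ a b c d, M = !![a, b; c, d] := ⟨_, _, _, _, Matrix.eta_fin_two M⟩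
  rw [Matrix.det_fin_two_of] at hM
  obtain ⟨s, rfl⟩ : 2 ∣ c := by simpa using hc
  obtain ⟨e, rfl⟩ : Odd d := by
    by_contra! hd
    obtain ⟨k, rfl⟩ := Int.not_odd_iff_even.mp hd
    have : 2 * (a * k - b * s) = 1 := by linear_combination hM
    lia
  exact ⟨_, expTwoPiI_ne_zero _, fun z hz ↦
    slash_etaQuotient (by linear_combination hM) hz⟩

theorem slash_etaQuotient_of_mem_congruenceMatrices {M : Matrix (Fin 2) (Fin 2) ℤ}
    (hM : M ∈ congruenceMatrices 1) {z : ℂ} (hz : 0 < z.im) :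
    slash M (etaQuotient 11 1) z = etaQuotient 11 1 z := by
  obtain ⟨a, b, c, d, rfl⟩ : ∃ a b c d, M = !![a, b; c, d] := ⟨_, _, _, _, Matrix.eta_fin_two M⟩
  simp only [congruenceMatrices, Matrix.det_fin_two_of, Set.mem_ofPred_eq, Matrix.of_apply,
    Matrix.cons_val', Matrix.cons_val_zero, Matrix.cons_val_one, Matrix.cons_val_fin_one] at hM
  obtain ⟨hdet, -, ⟨b, rfl⟩, ⟨s, rfl⟩, ⟨e, he⟩⟩ := hM
  obtain rfl : d = 2 * (12 * e) + 1 := by lia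
  have hE : 24 ∣ etaExponent a (24 * b) (24 * s) (12 * e) - 0 :=
    ⟨-(a + (24 * e + 1)) * s + b * (24 * e + 1) * (2 * (24 * s) ^ 2 + 13) + 3 * s * (24 * e + 1)
      + 3 * e * (12 * e + 1), by simp only [etaExponent]; ring⟩
  rw [show 48 * s = 2 * (24 * s) by ring, slash_etaQuotient (by linear_combination hdet) hz,
    expTwoPiI_div_congr hE]
  simp [expTwoPiI]

end Transformation

section Constancy

open Matrix UpperHalfPlane ModularForm
open scoped MatrixGroups

theorem coe_smul_eq_moebius (g : SL(2, ℤ)) (τ : ℍ) : ((g • τ : ℍ) : ℂ) = moebius g.1 τ := by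
  rw [UpperHalfPlane.specialLinearGroup_apply]
  simp [moebius]

/-- A function on the upper half plane which is holomorphic, invariant under `Γ₀(2)` and bounded at
both cusps is constant. -/
theorem eq_const_of_moebius_invariant {R : ℂ → ℂ}
    (hdiff : ∀ z : ℂ, 0 < z.im → DifferentiableAt ℂ R z)
    (hinv : ∀ M : Matrix (Fin 2) (Fin 2) ℤ, M.det = 1 → 2 ∣ M 1 0 →
      ∀ z : ℂ, 0 < z.im → R (moebius M z) = R z)
    (hinfty : ∃ C A : ℝ, ∀ z : ℂ, 0 < z.im → A ≤ z.im → ‖R z‖ ≤ C)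
    (hzero : ∃ C A : ℝ, ∀ z : ℂ, 0 < z.im → A ≤ z.im → ‖R (-1 / z)‖ ≤ C) :
    ∃ κ, ∀ z : ℂ, 0 < z.im → R z = κ := by
  let Γ : Subgroup (GL (Fin 2) ℝ) :=
    (CongruenceSubgroup.Gamma0 2).map (Matrix.SpecialLinearGroup.mapGL ℝ)
  have _ : Γ.IsArithmetic := inferInstanceAs
    (((CongruenceSubgroup.Gamma0 2).map (Matrix.SpecialLinearGroup.mapGL ℝ)).IsArithmetic)
  have hslash (g : SL(2, ℤ)) (τ : ℍ) :
      ((fun τ : ℍ ↦ R τ) ∣[(0 : ℤ)] g) τ = R (moebius g.1 τ) := by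
    rw [SL_slash_apply, neg_zero, zpow_zero, mul_one, coe_smul_eq_moebius]
  let F : ModularForm Γ 0 :=
    { toFun := fun τ ↦ R τ
      slash_action_eq' := by
        rintro _ ⟨g, hg, rfl⟩
        ext τ
        refine (hslash g τ).trans (hinv _ g.2 ?_ _ τ.2)
        exact (ZMod.intCast_zmod_eq_zero_iff_dvd _ 2).mp (CongruenceSubgroup.Gamma0_mem.mp hg)
      holo' := by
        rw [UpperHalfPlane.mdifferentiable_iff]
        intro z hz
        refine ((hdiff z hz).congr_of_eventuallyEq ?_).differentiableWithinAt
        filter_upwards [isOpen_upperHalfPlaneSet.mem_nhds hz] with w hw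
        simp [ofComplex_apply_of_im_pos hw]
      bdd_at_cusps' := by
        intro c hc
        rw [Subgroup.IsArithmetic.isCusp_iff_isCusp_SL2Z] at hc
        rw [OnePoint.isBoundedAt_iff_forall_SL2Z hc]
        intro g _
        rw [isBoundedAtImInfty_iff]
        simp only [hslash]
        obtain ⟨a, b, c, d, hg⟩ : ∃ a b c d, g.1 = !![a, b; c, d] :=
          ⟨_, _, _, _, Matrix.eta_fin_two g.1⟩
        have hdet : a * d - b * c = 1 := by
          rw [← Matrix.det_fin_two_of, ← hg, g.2]
        by_cases h2 : 2 ∣ c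
        · obtain ⟨C, A, h⟩ := hinfty
          refine ⟨C, A, fun τ hτ ↦ ?_⟩
          rw [hinv _ g.2 (by simpa [hg] using h2) _ τ.2]
          exact h _ τ.2 hτ
        · obtain ⟨C, A, h⟩ := hzero
          refine ⟨C, A, fun τ hτ ↦ ?_⟩
          have hmul : g.1 = !![-(b + d * a), a; -(d + d * c), c] * !![0, -1; 1, -d] := by
            rw [hg, Matrix.mul_fin_two]
            ring_nf
          have hdvd : 2 ∣ -(d + d * c) := by
            obtain ⟨k, rfl⟩ : Odd c := by
              rwa [← Int.not_even_iff_odd, even_iff_two_dvd]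
            exact ⟨-d * (k + 1), by ring⟩
          have him : 0 < (moebius !![0, -1; 1, -d] τ).im := moebius_im_pos (by simp) τ.2
          rw [hmul, moebius_mul _ _ (by simp) τ.2, hinv _ ?_ (by simpa using hdvd) _ him]
          · have : moebius !![0, -1; 1, -d] τ = -1 / ((τ : ℂ) - d) := by
              simp [moebius, sub_eq_add_neg]
            rw [this]
            exact h _ (by simpa using τ.2) (by simpa using hτ)
          · rw [Matrix.det_fin_two_of]
            linear_combination hdet }
  obtain ⟨κ, hκ⟩ := ModularForm.eq_const_of_weight_zero F
  exact ⟨κ, fun z hz ↦ congrFun hκ ⟨z, hz⟩⟩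

theorem differentiableAt_slash {M : Matrix (Fin 2) (Fin 2) ℤ} (hM : 0 < M.det) {f : ℂ → ℂ}
    (hf : ∀ z : ℂ, 0 < z.im → DifferentiableAt ℂ f z) {z : ℂ} (hz : 0 < z.im) :
    DifferentiableAt ℂ (slash M f) z := by
  have hd := moebius_denom_ne_zero hM.ne' hz
  have hmoebius : DifferentiableAt ℂ (moebius M) z := by
    unfold moebius
    fun_prop (disch := exact hd)
  have hcomp : DifferentiableAt ℂ (fun w ↦ f (moebius M w)) z :=
    (hf _ (moebius_im_pos hM hz)).comp z hmoebius
  exact hcomp.div (by fun_prop) (pow_ne_zero _ hd)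

theorem heckeRep_det_pos {p : ℕ} (hp : 0 < p) (i : Option (Fin p)) : 0 < (heckeRep p i).det := by
  cases i <;> simpa [heckeRep]

theorem differentiableAt_hecke {p : ℕ} (hp : 0 < p) {f : ℂ → ℂ}
    (hf : ∀ z : ℂ, 0 < z.im → DifferentiableAt ℂ f z) {z : ℂ} (hz : 0 < z.im) :
    DifferentiableAt ℂ (hecke p f) z :=
  DifferentiableAt.fun_sum fun i _ ↦ differentiableAt_slash (heckeRep_det_pos hp i) hf hz

theorem hecke_eq_const_mul {p : ℕ} (hp : 0 < p) {f g : ℂ → ℂ} {c : ℂ}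
    (hfg : ∀ z : ℂ, 0 < z.im → f z = c * g z) {z : ℂ} (hz : 0 < z.im) :
    hecke p f z = c * hecke p g z := by
  rw [hecke, hecke, Finset.mul_sum]
  refine Finset.sum_congr rfl fun i _ ↦ ?_
  rw [slash_congr (heckeRep_det_pos hp i) hfg hz, slash_const_mul]

theorem hecke_div_moebius {p : ℕ} (hp : p.Prime) (hp1 : p % 24 = 1) {f g : ℂ → ℂ}
    (hf : ∀ D ∈ congruenceMatrices 1, ∀ z : ℂ, 0 < z.im → slash D f z = f z)
    {N : Matrix (Fin 2) (Fin 2) ℤ} (hN : NormalizesCongruence N) {c : ℂ} (hc : c ≠ 0)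
    (hfg : ∀ z : ℂ, 0 < z.im → slash N f z = c * g z) {z : ℂ} (hz : 0 < z.im) :
    hecke p f (moebius N z) / f (moebius N z) = hecke p g z / g z := by
  have hd := pow_ne_zero 6 (moebius_denom_ne_zero hN.det_pos.ne' hz)
  rw [← mul_div_mul_left (hecke p g z) _ hc, ← hfg z hz, ← hecke_eq_const_mul hp.pos hfg hz,
    ← slash_hecke hp hp1 hf hN hz, slash_eq, slash_eq, div_div_div_cancel_right₀ hd]

theorem exists_norm_hecke_div_etaQuotient_le {p r s : ℕ} (hp : p.Prime) (hp1 : p % 24 = 1)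
    (hrs : r + 2 * s < 24) : ∃ C A : ℝ, ∀ z : ℂ, A ≤ z.im →
      ‖hecke p (etaQuotient r s) z / etaQuotient r s z‖ ≤ C := by
  have hp24 : p = 24 * (p / 24) + 1 := by lia
  have hlt : (r + 2 * s) * (p / 24) ≤ 23 * (p / 24) := Nat.mul_le_mul_right _ (by lia)
  obtain ⟨C, A, -, h⟩ := exists_norm_div_etaQuotient_le fun z hz ↦
    hasSum_hecke (fun z hz ↦ hasSum_etaQuotient r s hz) hp (by have := hp.two_le; lia)
      (D := (r + 2 * s) * (p / 24)) (by lia)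
      (by conv_rhs => rw [hp24]
          ring) hz
  exact ⟨C, A, h⟩

theorem exists_hecke_etaQuotient_eq {p : ℕ} (hp : p.Prime) (hp1 : p % 24 = 1) :
    ∃ κ, ∀ z : ℂ, 0 < z.im → hecke p (etaQuotient 11 1) z = κ * etaQuotient 11 1 z := by
  have hf : ∀ D ∈ congruenceMatrices 1, ∀ z : ℂ, 0 < z.im →
      slash D (etaQuotient 11 1) z = etaQuotient 11 1 z := fun D hD z hz ↦
    slash_etaQuotient_of_mem_congruenceMatrices hD hz
  obtain ⟨κ, hκ⟩ := eq_const_of_moebius_invariant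
    (R := fun z ↦ hecke p (etaQuotient 11 1) z / etaQuotient 11 1 z)
    (fun z hz ↦ (differentiableAt_hecke hp.pos
      (fun w hw ↦ differentiableAt_etaQuotient 11 1 hw) hz).div
        (differentiableAt_etaQuotient 11 1 hz) (etaQuotient_ne_zero 11 1 hz))
    (fun M hM hM2 z hz ↦ by
      obtain ⟨c, hc, h⟩ := exists_slash_etaQuotient hM hM2
      exact hecke_div_moebius hp hp1 hf (normalizesCongruence_of_det_eq_one hM hM2) hc h hz)
    (by
      obtain ⟨C, A, h⟩ := exists_norm_hecke_div_etaQuotient_le (r := 11) (s := 1) hp hp1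
        (by norm_num)
      exact ⟨C, A, fun z _ hz ↦ h z hz⟩)
    (by
      obtain ⟨C, A, h⟩ := exists_norm_hecke_div_etaQuotient_le (r := 1) (s := 11) hp hp1
        (by norm_num)
      refine ⟨C, 2 * A, fun z hz0 hz ↦ ?_⟩
      have him : (z / 2).im = z.im / 2 := by simp
      have hsqrt : -(Complex.sqrt 2) ^ 11 / 64 ≠ 0 := by
        simp [Complex.sqrt]
      have hz2 : -1 / z = moebius fricke (z / 2) := by
        simp [moebius, fricke, mul_div_cancel₀]
      rw [hz2, hecke_div_moebius hp hp1 hf normalizesCongruence_fricke hsqrt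
        (fun z hz ↦ slash_fricke_etaQuotient (r := 11) (s := 1) rfl hz) (by rw [him]; linarith)]
      exact h _ (by rw [him]; linarith))
  exact ⟨κ, fun z hz ↦ by rw [← hκ z hz, div_mul_cancel₀ _ (etaQuotient_ne_zero 11 1 hz)]⟩

end Constancy

section Congruence

open PowerSeries

theorem coeff_etaSeries_intCast (r s n : ℕ) :
    coeff n (etaSeries ℂ r s) = (coeff n (etaSeries ℤ r s) : ℤ) := by
  rw [← map_etaSeries (Int.castRingHom ℂ), coeff_map, eq_intCast]

theorem coeff_etaSeries_hecke {p : ℕ} (hp : p.Prime) (hp1 : p % 24 = 1) (n : ℕ) :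
    coeff (p * n + 13 * (p - 1) / 24) (etaSeries ℤ 11 1) +
      p ^ 5 * (if 13 * (p - 1) / 24 ≤ n ∧ p ∣ n - 13 * (p - 1) / 24 then
        coeff ((n - 13 * (p - 1) / 24) / p) (etaSeries ℤ 11 1) else 0) =
      coeff (13 * (p - 1) / 24) (etaSeries ℤ 11 1) * coeff n (etaSeries ℤ 11 1) := by
  have hp0 : (p : ℂ) ≠ 0 := Nat.cast_ne_zero.mpr hp.ne_zero
  have hpos := hp.two_le
  set D := 13 * (p - 1) / 24 with hD
  have hDp : D < p := by lia
  have hD0 : 0 < D := by lia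
  obtain ⟨κ, hκ⟩ := exists_hecke_etaQuotient_eq hp hp1
  have h := coeff_eq_of_eq_const_mul_etaQuotient (fun z hz ↦
    hasSum_hecke (fun z hz ↦ hasSum_etaQuotient 11 1 hz) hp (by lia) hDp (by lia) hz) hκ
  have h0 := h 0
  rw [coeff_zero_etaSeries, mul_one, heckeCoeff, if_neg (by lia), mul_zero, zero_add, add_zero]
    at h0
  have hn := h n
  rw [← h0, heckeCoeff] at hn
  simp only [coeff_etaSeries_intCast] at hn
  field_simp at hn
  split_ifs at hn ⊢ <;> exact_mod_cast hn

theorem dvd_coeff_etaSeries {p : ℕ} (hp : p.Prime) (hp1 : p % 24 = 1) {k : ℤ}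
    (h : k ∣ coeff (13 * (p - 1) / 24) (etaSeries ℤ 11 1)) {n : ℕ} (hn : ¬ p ∣ 24 * n + 13)
    (α : ℕ) :
    k ∣ coeff (p ^ (2 * α + 1) * n + 13 * (p ^ (2 * α + 1) - 1) / 24) (etaSeries ℤ 11 1) := by
  have hpos := hp.two_le
  set D := 13 * (p - 1) / 24 with hD
  have h24 : 24 * D + 13 = 13 * p := by lia
  induction α with
  | zero =>
    have key := coeff_etaSeries_hecke hp hp1 n
    rw [← hD, if_neg, mul_zero, add_zero] at key
    · simpa [← hD, key] using h.mul_right _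
    · rintro ⟨hle, c, hc⟩
      refine hn ⟨24 * c + 13, ?_⟩
      obtain rfl : n = D + p * c := by lia
      linear_combination h24
  | succ α ih =>
    set N := p ^ (2 * α + 1) * n + 13 * (p ^ (2 * α + 1) - 1) / 24
    have hpow (β : ℕ) : p ^ β % 24 = 1 := by
      simp [Nat.pow_mod, hp1]
    have hN : p ^ (2 * (α + 1) + 1) * n + 13 * (p ^ (2 * (α + 1) + 1) - 1) / 24 =
        p * (p * N + D) + D := by
      have h1 : 24 * N + 13 = p ^ (2 * α + 1) * (24 * n + 13) := by
        have : 24 * (13 * (p ^ (2 * α + 1) - 1) / 24) + 13 = 13 * p ^ (2 * α + 1) := by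
          have := hpow (2 * α + 1)
          lia
        simp only [N]
        linear_combination this
      have h2 : 24 * (13 * (p ^ (2 * (α + 1) + 1) - 1) / 24) + 13 =
          13 * p ^ (2 * (α + 1) + 1) := by
        have := hpow (2 * (α + 1) + 1)
        lia
      refine Nat.eq_of_mul_eq_mul_left (show 0 < 24 by norm_num) (Nat.add_right_cancel (m := 13) ?_)
      linear_combination h2 - p ^ 2 * h1 - (p + 1) * h24
    have key := coeff_etaSeries_hecke hp hp1 (p * N + D)
    rw [← hD, if_pos ⟨Nat.le_add_left _ _, by simp⟩, Nat.add_sub_cancel,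
      Nat.mul_div_cancel_left _ hp.pos] at key
    rw [hN, eq_sub_of_add_eq key]
    exact dvd_sub (h.mul_right _) (ih.mul_left _)

end Congruence

/-- Theorem 1.7(iii). -/
theorem B_13_2_newman_cong (p : ℕ) (hp : p.Prime) (hp1 : p % 24 = 1)
    (hB : B 13 2 (13 * (p - 1) / 24) ≡ 0 [MOD 13]) (α n : ℕ) (hn : ¬ p ∣ (24 * n + 13)) :
    B 13 2 (p ^ (2 * α + 1) * n + 13 * (p ^ (2 * α + 1) - 1) / 24) ≡ 0 [MOD 13] := by
  rw [B_modEq_zero_iff] at hB ⊢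
  exact dvd_coeff_etaSeries hp hp1 hB hn α
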